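/- arXiv:2502.18976 — 2 statements merged into one kernel-verified Lean document; each statement's English description precedes it below -/
import Mathlib

section
/- Let p ≥ 5 be a prime and let D ∈ ℤ_p be such that the image of D − 4 in ℤ/pℤ is a nonzero square; if p = 5, assume additionally that the image of D in ℤ/5ℤ is not 3. Then there exists a point (x₀, y₀, z₀) ∈ ℤ_p³ with x₀² + y₀² + z₀² − x₀y₀z₀ = D such that: x₀ is congruent to 2 or −2 modulo p; neither y₀ nor z₀ is congruent to 2 or −2 modulo p; and each of 2x₀ − y₀z₀, 2y₀ − x₀z₀, 2z₀ − x₀y₀ is a unit of ℤ_p. -/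
open Polynomial

noncomputable section

/-- The companion matrix `C(x) = [[x, -1], [1, 0]]`. -/
def cmat {R : Type*} [CommRing R] (x : R) : Matrix (Fin 2) (Fin 2) R := !![x, -1; 1, 0]

def chebTAux : ℕ → Polynomial ℤ
  | 0 => 2
  | 1 => X
  | n + 2 => X * chebTAux (n + 1) - chebTAux n

def chebUAux : ℕ → Polynomial ℤ
  | 0 => 1
  | 1 => X
  | n + 2 => X * chebUAux (n + 1) - chebUAux n

/-- The monic Chebyshev polynomial of the first kind `T_n` (`n ∈ ℤ`), defined by the
recurrence `T_n = X T_{n-1} - T_{n-2}` with `T_{-1} = X`, `T_0 = 2`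
(using the symmetry `T_{-n} = T_n`). -/
def chebT (n : ℤ) : Polynomial ℤ := chebTAux n.natAbs

/-- The monic Chebyshev polynomial of the second kind `U_n` (`n ∈ ℤ`), defined by the
recurrence `U_n = X U_{n-1} - U_{n-2}` with `U_{-1} = 0`, `U_0 = 1`
(using the symmetry `U_{-n-2} = -U_n`). -/
def chebU (n : ℤ) : Polynomial ℤ :=
  if 0 ≤ n then chebUAux n.toNat
  else if n = -1 then 0
  else -chebUAux (-(n + 2)).toNat

/-- The Vieta involution `s_x : (x, y, z) ↦ (yz - x, y, z)`. -/
def vietaSx (R : Type*) [CommRing R] : Equiv.Perm (R × R × R) :=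
  Function.Involutive.toPerm (fun v => (v.2.1 * v.2.2 - v.1, v.2.1, v.2.2)) (by
    rintro ⟨x, y, z⟩; simp)

/-- The Vieta involution `s_y : (x, y, z) ↦ (x, xz - y, z)`. -/
def vietaSy (R : Type*) [CommRing R] : Equiv.Perm (R × R × R) :=
  Function.Involutive.toPerm (fun v => (v.1, v.1 * v.2.2 - v.2.1, v.2.2)) (by
    rintro ⟨x, y, z⟩; simp)

/-- The Vieta involution `s_z : (x, y, z) ↦ (x, y, xy - z)`. -/
def vietaSz (R : Type*) [CommRing R] : Equiv.Perm (R × R × R) :=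
  Function.Involutive.toPerm (fun v => (v.1, v.2.1, v.1 * v.2.1 - v.2.2)) (by
    rintro ⟨x, y, z⟩; simp)

/-- The double sign change `(x, y, z) ↦ (x, -y, -z)`. -/
def signYZ (R : Type*) [CommRing R] : Equiv.Perm (R × R × R) :=
  Function.Involutive.toPerm (fun v => (v.1, -v.2.1, -v.2.2)) (by
    rintro ⟨x, y, z⟩; simp)

/-- The double sign change `(x, y, z) ↦ (-x, y, -z)`. -/
def signXZ (R : Type*) [CommRing R] : Equiv.Perm (R × R × R) :=
  Function.Involutive.toPerm (fun v => (-v.1, v.2.1, -v.2.2)) (by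
    rintro ⟨x, y, z⟩; simp)

/-- The double sign change `(x, y, z) ↦ (-x, -y, z)`. -/
def signXY (R : Type*) [CommRing R] : Equiv.Perm (R × R × R) :=
  Function.Involutive.toPerm (fun v => (-v.1, -v.2.1, v.2.2)) (by
    rintro ⟨x, y, z⟩; simp)

/-- The coordinate transposition `(x, y, z) ↦ (y, x, z)`. -/
def swapXY (R : Type*) [CommRing R] : Equiv.Perm (R × R × R) :=
  Function.Involutive.toPerm (fun v => (v.2.1, v.1, v.2.2)) (by
    rintro ⟨x, y, z⟩; simp)

/-- The coordinate transposition `(x, y, z) ↦ (x, z, y)`. -/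
def swapYZ (R : Type*) [CommRing R] : Equiv.Perm (R × R × R) :=
  Function.Involutive.toPerm (fun v => (v.1, v.2.2, v.2.1)) (by
    rintro ⟨x, y, z⟩; simp)

/-- The coordinate transposition `(x, y, z) ↦ (z, y, x)`. -/
def swapXZ (R : Type*) [CommRing R] : Equiv.Perm (R × R × R) :=
  Function.Involutive.toPerm (fun v => (v.2.2, v.2.1, v.1)) (by
    rintro ⟨x, y, z⟩; simp)

/-- The nonsingular locus `X_D^*(R)` of the Markoff surface
`x² + y² + z² - xyz = D`: points where one of `2x - yz`, `2y - xz`, `2z - xy` is a unit. -/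
def markoffSet (R : Type*) [CommRing R] (D : R) : Set (R × R × R) :=
  {v | v.1 ^ 2 + v.2.1 ^ 2 + v.2.2 ^ 2 - v.1 * v.2.1 * v.2.2 = D ∧
    (IsUnit (2 * v.1 - v.2.1 * v.2.2) ∨ IsUnit (2 * v.2.1 - v.1 * v.2.2) ∨
      IsUnit (2 * v.2.2 - v.1 * v.2.1))}

/-- The group `Γ` generated by the three Vieta involutions. -/
def vietaGroup (R : Type*) [CommRing R] : Subgroup (Equiv.Perm (R × R × R)) :=
  Subgroup.closure {vietaSx R, vietaSy R, vietaSz R}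

/-- The group generated by the Vieta involutions, double sign changes and all
permutations of the coordinates (the transpositions generate all permutations). -/
def fullAutGroup (R : Type*) [CommRing R] : Subgroup (Equiv.Perm (R × R × R)) :=
  Subgroup.closure {vietaSx R, vietaSy R, vietaSz R, signYZ R, signXZ R, signXY R,
    swapXY R, swapYZ R, swapXZ R}

theorem PadicInt.isUnit_iff_toZMod_ne_zero {p : ℕ} [Fact p.Prime] {a : ℤ_[p]} :
    IsUnit a ↔ PadicInt.toZMod a ≠ 0 := by
  rw [Ne, ← RingHom.mem_ker, PadicInt.ker_toZMod, IsLocalRing.mem_maximalIdeal, mem_nonunits_iff,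
    not_not]

theorem PadicInt.toZMod_eq_zero_of_norm_le_inv {p : ℕ} [Fact p.Prime] {a : ℤ_[p]}
    (h : ‖a‖ ≤ (p : ℝ)⁻¹) : PadicInt.toZMod a = 0 := by
  by_contra hne
  have h1 := PadicInt.isUnit_iff.mp (PadicInt.isUnit_iff_toZMod_ne_zero.mpr hne)
  have h2 : (p : ℝ)⁻¹ < 1 :=
    inv_lt_one_of_one_lt₀ (by exact_mod_cast (Fact.out : p.Prime).one_lt)
  linarith

/-- Hensel lifting of square roots: for odd `p`, a nonzero square root of `a` modulo `p` lifts
to a square root of `a` in `ℤ_p`. -/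
theorem PadicInt.exists_sq_eq_of_toZMod {p : ℕ} [Fact p.Prime] (hp : (2 : ZMod p) ≠ 0)
    {a : ℤ_[p]} {t : ZMod p} (ht : t ≠ 0) (hta : t ^ 2 = PadicInt.toZMod a) :
    ∃ τ : ℤ_[p], τ ^ 2 = a ∧ PadicInt.toZMod τ = t := by
  obtain ⟨b, rfl⟩ := ZMod.ringHom_surjective (PadicInt.toZMod (p := p)) t
  have hF : ‖(X ^ 2 - C a : ℤ_[p][X]).aeval b‖ < 1 := by
    rw [← PadicInt.mem_nonunits, ← IsLocalRing.mem_maximalIdeal, ← PadicInt.ker_toZMod,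
      RingHom.mem_ker]
    simp [hta]
  have hd : ‖(X ^ 2 - C a : ℤ_[p][X]).derivative.aeval b‖ = 1 := by
    rw [← PadicInt.isUnit_iff, PadicInt.isUnit_iff_toZMod_ne_zero]
    have m2 : PadicInt.toZMod (2 : ℤ_[p]) = 2 := map_ofNat _ 2
    simpa [one_add_one_eq_two, m2] using And.intro hp ht
  obtain ⟨τ, h0, hτ, -, -⟩ := hensels_lemma (F := (X ^ 2 - C a : ℤ_[p][X])) (a := b)
    (by rw [hd]; simpa using hF)
  refine ⟨τ, sub_eq_zero.mp (by simpa using h0), ?_⟩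
  rw [hd, ← PadicInt.mem_nonunits, ← IsLocalRing.mem_maximalIdeal, ← PadicInt.ker_toZMod,
    RingHom.mem_ker, map_sub, sub_eq_zero] at hτ
  exact hτ

/-- On the plane `x = 2` the Markoff surface is `(y - z)² = D - 4`; residue conditions on `y` and
`z = y + τ` make this a point with the required properties. -/
theorem exists_markoff_point_of_sq {p : ℕ} [Fact p.Prime] (h2 : (2 : ZMod p) ≠ 0)
    {D τ y : ℤ_[p]} (hτ : τ ^ 2 = D - 4) {s v : ZMod p} (hs : PadicInt.toZMod τ = s)
    (hv : PadicInt.toZMod y = v) (hs0 : s ≠ 0) (hv2 : v - 2 ≠ 0) (hv2' : v + 2 ≠ 0)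
    (hw2 : v + s - 2 ≠ 0) (hw2' : v + s + 2 ≠ 0) (hvw : 2 * 2 - v * (v + s) ≠ 0) :
    ∃ x₀ y₀ z₀ : ℤ_[p],
      x₀ ^ 2 + y₀ ^ 2 + z₀ ^ 2 - x₀ * y₀ * z₀ = D ∧
      (‖x₀ - 2‖ ≤ ((p : ℝ))⁻¹ ∨ ‖x₀ + 2‖ ≤ ((p : ℝ))⁻¹) ∧
      ¬(‖y₀ - 2‖ ≤ ((p : ℝ))⁻¹ ∨ ‖y₀ + 2‖ ≤ ((p : ℝ))⁻¹) ∧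
      ¬(‖z₀ - 2‖ ≤ ((p : ℝ))⁻¹ ∨ ‖z₀ + 2‖ ≤ ((p : ℝ))⁻¹) ∧
      IsUnit (2 * x₀ - y₀ * z₀) ∧ IsUnit (2 * y₀ - x₀ * z₀) ∧
      IsUnit (2 * z₀ - x₀ * y₀) := by
  have m2 : PadicInt.toZMod (2 : ℤ_[p]) = 2 := map_ofNat _ 2
  have h2s : 2 * s ≠ 0 := mul_ne_zero h2 hs0
  refine ⟨2, y, y + τ, by linear_combination hτ, Or.inl (by simp), ?_, ?_, ?_, ?_, ?_⟩
  · rintro (h | h) <;> have h' := PadicInt.toZMod_eq_zero_of_norm_le_inv h <;>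
      simp only [map_sub, map_add, m2, hv] at h' <;> contradiction
  · rintro (h | h) <;> have h' := PadicInt.toZMod_eq_zero_of_norm_le_inv h <;>
      simp only [map_sub, map_add, m2, hv, hs] at h' <;> contradiction
  all_goals
    rw [PadicInt.isUnit_iff_toZMod_ne_zero]
    simp only [map_sub, map_add, map_mul, m2, hv, hs]
  · exact hvw
  · exact fun h => h2s (by linear_combination -h)
  · exact fun h => h2s (by linear_combination h)

/-- If `p ≥ 5` is prime, `D - 4` reduces to a nonzero square mod `p`,
and (for `p = 5`) `D` does not reduce to `3`, then there is a point on the surface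
`x² + y² + z² - xyz = D` with `x₀ ≡ ±2 (mod p)`, `y₀, z₀ ≢ ±2 (mod p)`, and all three
partial derivatives `2x₀ - y₀z₀`, `2y₀ - x₀z₀`, `2z₀ - x₀y₀` units of `ℤ_p`. -/
theorem stmt18 (p : ℕ) [Fact p.Prime] (hp : 5 ≤ p) (D : ℤ_[p])
    (hQR : ∃ t : ZMod p, t ≠ 0 ∧ t ^ 2 = PadicInt.toZMod (D - 4))
    (h5 : p = 5 → PadicInt.toZMod D ≠ 3) :
    ∃ x₀ y₀ z₀ : ℤ_[p],
      x₀ ^ 2 + y₀ ^ 2 + z₀ ^ 2 - x₀ * y₀ * z₀ = D ∧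
      (‖x₀ - 2‖ ≤ ((p : ℝ))⁻¹ ∨ ‖x₀ + 2‖ ≤ ((p : ℝ))⁻¹) ∧
      ¬(‖y₀ - 2‖ ≤ ((p : ℝ))⁻¹ ∨ ‖y₀ + 2‖ ≤ ((p : ℝ))⁻¹) ∧
      ¬(‖z₀ - 2‖ ≤ ((p : ℝ))⁻¹ ∨ ‖z₀ + 2‖ ≤ ((p : ℝ))⁻¹) ∧
      IsUnit (2 * x₀ - y₀ * z₀) ∧ IsUnit (2 * y₀ - x₀ * z₀) ∧
      IsUnit (2 * z₀ - x₀ * y₀) := by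
  have hcast (n : ℕ) (h0 : 0 < n) (hn : n < p) : (n : ZMod p) ≠ 0 := by
    rw [Ne, ZMod.natCast_eq_zero_iff]
    exact Nat.not_dvd_of_pos_of_lt h0 hn
  have h1 : (1 : ZMod p) ≠ 0 := one_ne_zero
  have h2 : (2 : ZMod p) ≠ 0 := by exact_mod_cast hcast 2 (by omega) (by omega)
  have h3 : (3 : ZMod p) ≠ 0 := by exact_mod_cast hcast 3 (by omega) (by omega)
  have h4 : (4 : ZMod p) ≠ 0 := by exact_mod_cast hcast 4 (by omega) (by omega)
  obtain ⟨t, ht, hsq⟩ := hQR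
  by_cases htwo : t ^ 2 = 4
  · have hp5 : p ≠ 5 := by
      intro h
      have h50 : (5 : ZMod p) = 0 := by
        exact_mod_cast (ZMod.natCast_eq_zero_iff 5 p).mpr h.dvd
      apply h5 h
      have m4 : PadicInt.toZMod (4 : ℤ_[p]) = 4 := map_ofNat _ 4
      rw [map_sub, m4] at hsq
      linear_combination htwo - hsq + h50
    have h5' : (5 : ZMod p) ≠ 0 := by exact_mod_cast hcast 5 (by omega) (by omega)
    obtain ⟨τ, hτ, hτ2⟩ := PadicInt.exists_sq_eq_of_toZMod h2 h2
      (show (2 : ZMod p) ^ 2 = _ by rw [← hsq, htwo]; norm_num)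
    exact exists_markoff_point_of_sq h2 hτ hτ2 (map_one _) h2
      (fun h => h1 (by linear_combination -h)) (fun h => h3 (by linear_combination h))
      (fun h => h1 (by linear_combination h)) (fun h => h5' (by linear_combination h))
      (fun h => h1 (by linear_combination h))
  · obtain ⟨τ, hτ, hτt⟩ := PadicInt.exists_sq_eq_of_toZMod h2 ht hsq
    exact exists_markoff_point_of_sq h2 hτ hτt (map_zero _) ht
      (fun h => h2 (by linear_combination -h)) (fun h => h2 (by linear_combination h))
      (fun h => htwo (by linear_combination (t + 2) * h))
      (fun h => htwo (by linear_combination (t - 2) * h))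
      (fun h => h4 (by linear_combination h))
end
end

section
/- Let p be a prime and let Δ be a group of bijections of ℤ_p², each of which is an isometry for the sup distance. Suppose (i) (residual transitivity) for all a, b ∈ ℤ_p² there exists δ ∈ Δ with dist(δ(a), b) ≤ p⁻¹, and (ii) (minimal subdisk) there exist (u₀, v₀) ∈ ℤ_p² and a subgroup Δ₀ of Δ such that every element of Δ₀ maps the polydisk B = (u₀ + pℤ_p) × (v₀ + pℤ_p) into itself, and for every a ∈ B the set {δ(a) : δ ∈ Δ₀} is dense in B. Then Δ acts minimally on ℤ_p²: for every a ∈ ℤ_p², the orbit {δ(a) : δ ∈ Δ} is dense in ℤ_p². -/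
open Polynomial

noncomputable section

/-- The polydisk `(u₀ + pℤ_p) × (v₀ + pℤ_p)`. -/
def pDisk (p : ℕ) [Fact p.Prime] (x₀ : ℤ_[p] × ℤ_[p]) : Set (ℤ_[p] × ℤ_[p]) :=
  {x | ‖x.1 - x₀.1‖ ≤ ((p : ℝ))⁻¹ ∧ ‖x.2 - x₀.2‖ ≤ ((p : ℝ))⁻¹}

/-- minimality criterion. If a group `Δ` of isometric bijections of
`ℤ_p²` is residually transitive and has a subgroup acting invariantly and minimally on
some polydisk `(u₀ + pℤ_p) × (v₀ + pℤ_p)`, then `Δ` acts minimally on `ℤ_p²`. -/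
theorem stmt19 (p : ℕ) [Fact p.Prime]
    (Δ : Subgroup (Equiv.Perm (ℤ_[p] × ℤ_[p])))
    (hiso : ∀ δ ∈ Δ, ∀ a b : ℤ_[p] × ℤ_[p], dist (δ a) (δ b) = dist a b)
    (htrans : ∀ a b : ℤ_[p] × ℤ_[p], ∃ δ ∈ Δ, dist (δ a) b ≤ ((p : ℝ))⁻¹)
    (hsub : ∃ u₀ v₀ : ℤ_[p], ∃ Δ₀ : Subgroup (Equiv.Perm (ℤ_[p] × ℤ_[p])), Δ₀ ≤ Δ ∧
      (∀ δ ∈ Δ₀, ∀ x ∈ pDisk p (u₀, v₀), δ x ∈ pDisk p (u₀, v₀)) ∧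
      (∀ a ∈ pDisk p (u₀, v₀), ∀ b ∈ pDisk p (u₀, v₀), ∀ ε > (0 : ℝ),
        ∃ δ ∈ Δ₀, dist (δ a) b < ε)) :
    ∀ a b : ℤ_[p] × ℤ_[p], ∀ ε > (0 : ℝ), ∃ δ ∈ Δ, dist (δ a) b < ε := by
  intro a b ε hε
  obtain ⟨u₀, v₀, Δ₀, hle, -, hmin⟩ := hsub
  have hmem : ∀ x : ℤ_[p] × ℤ_[p], dist x (u₀, v₀) ≤ ((p : ℝ))⁻¹ → x ∈ pDisk p (u₀, v₀) := by
    intro x hx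
    rw [Prod.dist_eq, max_le_iff, dist_eq_norm, dist_eq_norm] at hx
    exact hx
  obtain ⟨δ₁, h₁, ha⟩ := htrans a (u₀, v₀)
  obtain ⟨δ₂, h₂, hb⟩ := htrans b (u₀, v₀)
  obtain ⟨δ, hδ, hd⟩ := hmin _ (hmem _ ha) _ (hmem _ hb) ε hε
  refine ⟨δ₂⁻¹ * (δ * δ₁), Δ.mul_mem (Δ.inv_mem h₂) (Δ.mul_mem (hle hδ) h₁), ?_⟩
  rw [← hiso δ₂ h₂]
  simpa [Equiv.Perm.mul_apply] using hd
end
end
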